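/- Let α ∈ (0,1), τ, C, C' > 0 and β₀ > β₁ > 0 be given. If (ρ_n) is a sequence of nonnegative reals such that there exists an α-uniformly consistent test of H₀: F ∈ S(τ,β₀,C,C') against H₁: F ∈ S̃(τ,β₁,β₀,C,C',ρ_n), then necessarily liminf_{n→∞} ρ_n·n^{β₁/(2β₁+1)} > 0. -/

import Mathlib

open MeasureTheory Filter Set Asymptotics

noncomputable section

/-- The CDF of a measure on `ℝ`. -/
def cdfR (μ : Measure ℝ) (x : ℝ) : ℝ := (μ (Iic x)).toReal

/-- The second order Pareto class `S(τ, β, C, C')`: càdlàg distribution functions on `[0,∞)`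
(here encoded via their laws, probability measures giving no mass to `(-∞,0)`) such that
`|1 - F(x) - C·x^(-τ)| ≤ C'·x^(-τ(β+1))` whenever `F(x) ∈ (0,1]`. -/
def SOP (τ β C C' : ℝ) : Set (Measure ℝ) :=
  {μ | IsProbabilityMeasure μ ∧ μ (Iio 0) = 0 ∧
    ∀ x : ℝ, cdfR μ x ∈ Ioc (0 : ℝ) 1 →
      |1 - cdfR μ x - C * x ^ (-τ)| ≤ C' * x ^ (-(τ * (β + 1)))}

/-- The distance `‖F - S‖_{∞,τ} = inf_{F₀ ∈ S} sup_{x : F(x) ∈ (0,1)} |x^τ(1-F(x)) - x^τ(1-F₀(x))|`. -/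
def distToSet (τ : ℝ) (μ : Measure ℝ) (S : Set (Measure ℝ)) : ℝ :=
  ⨅ ν : S, ⨆ x : {x : ℝ | cdfR μ x ∈ Ioo (0 : ℝ) 1},
    |(x : ℝ) ^ τ * (1 - cdfR μ (x : ℝ)) - (x : ℝ) ^ τ * (1 - cdfR (ν : Measure ℝ) (x : ℝ))|

/-- The separated class `S̃(τ, β₁, β₀, C, C', ρ)`. -/
def SOPsep (τ β₁ β₀ C C' ρ : ℝ) : Set (Measure ℝ) :=
  {μ | μ ∈ SOP τ β₁ C C' ∧ ρ ≤ distToSet τ μ (SOP τ β₀ C C')}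

/-- Joint law of `n` i.i.d. observations with common law `μ`. -/
def iidP (μ : Measure ℝ) (n : ℕ) : Measure (Fin n → ℝ) := Measure.pi fun _ => μ

/-- A sequence of tests (given by their rejection regions `R n`) is `α`-uniformly consistent
for hypotheses `H₀ n`, `H₁ n` if, for all sufficiently large `n`,
`sup_{F ∈ H₀} E_F[Ψ_n] + sup_{F ∈ H₁} E_F[1 - Ψ_n] ≤ α`. -/
def UnifConsistent (α : ℝ) (H₀ H₁ : ℕ → Set (Measure ℝ))
    (R : (n : ℕ) → Set (Fin n → ℝ)) : Prop :=
  (∀ n, MeasurableSet (R n)) ∧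
  ∀ᶠ n : ℕ in atTop,
    (⨆ μ : H₀ n, (iidP (μ : Measure ℝ) n (R n)).toReal) +
      (⨆ μ : H₁ n, (1 - (iidP (μ : Measure ℝ) n (R n)).toReal)) ≤ α

theorem pi_withDensity_ofReal {Ω ι : Type*} [MeasurableSpace Ω] [Fintype ι]
    (μ : Measure Ω) [SigmaFinite μ] {h : Ω → ℝ} (h_nonneg : ∀ x, 0 ≤ h x)
    (h_int : Integrable h μ) :
    Measure.pi (fun _ : ι => μ.withDensity fun x => ENNReal.ofReal (h x)) =
      (Measure.pi fun _ : ι => μ).withDensity fun x => ENNReal.ofReal (∏ i, h (x i)) := by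
  have : IsFiniteMeasure (μ.withDensity fun x => ENNReal.ofReal (h x)) :=
    isFiniteMeasure_withDensity_ofReal h_int.2
  refine Measure.pi_eq fun s hs => ?_
  have h_prod : Integrable (fun x : ι → Ω => ∏ i, h (x i)) (Measure.pi fun _ => μ) :=
    Integrable.fintype_prod fun _ => h_int
  rw [withDensity_apply _ (.univ_pi hs), ← ofReal_integral_eq_lintegral_ofReal
    h_prod.integrableOn (ae_of_all _ fun x => Finset.prod_nonneg fun i _ => h_nonneg _),
    Measure.restrict_pi_pi, integral_fintype_prod_eq_prod (fun _ => h),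
    ENNReal.ofReal_prod_of_nonneg fun i _ => integral_nonneg h_nonneg]
  refine Finset.prod_congr rfl fun i _ => ?_
  rw [withDensity_apply _ (hs i), ofReal_integral_eq_lintegral_ofReal h_int.integrableOn
    (ae_of_all _ h_nonneg)]

/-- The second moment method: if `(∫ h² ∂μ)ⁿ - 1 < δ²`, then no event separates the `n`-fold
products of `μ` and `h • μ` by `δ` or more. -/
theorem pi_withDensity_sub_pi_lt {Ω ι : Type*} [MeasurableSpace Ω] [Fintype ι]
    (μ : Measure Ω) [IsProbabilityMeasure μ] {h : Ω → ℝ} (h_nonneg : ∀ x, 0 ≤ h x)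
    (h_int : Integrable h μ) (h_sq : Integrable (fun x => h x ^ 2) μ) (h_one : ∫ x, h x ∂μ = 1)
    {δ : ℝ} (hδ : 0 < δ) (h_lt : (∫ x, h x ^ 2 ∂μ) ^ Fintype.card ι - 1 < δ ^ 2)
    {R : Set (ι → Ω)} (hR : MeasurableSet R) :
    (Measure.pi (fun _ : ι => μ.withDensity fun x => ENNReal.ofReal (h x)) R).toReal -
      (Measure.pi (fun _ : ι => μ) R).toReal < δ := by
  set P := Measure.pi (fun _ : ι => μ)
  set L : (ι → Ω) → ℝ := fun x => ∏ i, h (x i)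
  have hL0 : ∀ x, 0 ≤ L x := fun x => Finset.prod_nonneg fun i _ => h_nonneg _
  have hL : Integrable L P := Integrable.fintype_prod fun _ => h_int
  have hL2 : Integrable (fun x => L x ^ 2) P := by
    simpa only [L, ← Finset.prod_pow] using
      Integrable.fintype_prod (ι := ι) (μ := fun _ => μ) (f := fun _ x => h x ^ 2)
        fun _ => h_sq
  have iL : ∫ x, L x ∂P = 1 := by
    rw [integral_fintype_prod_eq_pow (fun x => h x), h_one, one_pow]
  have iL2 : ∫ x, L x ^ 2 ∂P = (∫ x, h x ^ 2 ∂μ) ^ Fintype.card ι := by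
    simp only [L, ← Finset.prod_pow]
    exact integral_fintype_prod_eq_pow (fun x => h x ^ 2)
  rw [pi_withDensity_ofReal μ h_nonneg h_int, withDensity_apply _ hR,
    ← ofReal_integral_eq_lintegral_ofReal hL.integrableOn (ae_of_all _ hL0),
    ENNReal.toReal_ofReal (integral_nonneg hL0)]
  have h1 : (P R).toReal = ∫ _ in R, (1 : ℝ) ∂P := by simp [Measure.real]
  rw [h1, ← integral_sub hL.integrableOn (integrable_const _), ← integral_indicator hR]
  have key : ∀ x, R.indicator (fun x => L x - 1) x ≤
      (2 * δ)⁻¹ * (L x ^ 2 - 2 * L x + (1 + δ ^ 2)) := by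
    intro x
    rw [inv_mul_eq_div, le_div_iff₀ (by positivity)]
    by_cases hx : x ∈ R
    · rw [indicator_of_mem hx]; nlinarith [sq_nonneg (L x - 1 - δ)]
    · rw [indicator_of_notMem hx]; nlinarith [sq_nonneg (L x - 1)]
  have i1 : Integrable (fun x => L x ^ 2 - 2 * L x) P := hL2.sub (hL.const_mul 2)
  calc ∫ x, R.indicator (fun x => L x - 1) x ∂P
      ≤ ∫ x, (2 * δ)⁻¹ * (L x ^ 2 - 2 * L x + (1 + δ ^ 2)) ∂P :=
        integral_mono ((hL.sub (integrable_const _)).indicator hR)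
          ((i1.add (integrable_const _)).const_mul _) key
    _ = (2 * δ)⁻¹ * ((∫ x, h x ^ 2 ∂μ) ^ Fintype.card ι - 1 + δ ^ 2) := by
        rw [integral_const_mul, integral_add i1 (integrable_const _),
          integral_sub hL2 (hL.const_mul 2), integral_const_mul, iL, iL2]
        simp only [integral_const, probReal_univ, one_smul]; ring
    _ < δ := by
        rw [inv_mul_eq_div, div_lt_iff₀ (by positivity)]; nlinarith

/-- The Pareto law with tail `C * x ^ (-τ)`. -/
def paretoLaw (τ C : ℝ) : Measure ℝ :=
  (volume.restrict (Ioo (0 : ℝ) 1)).map fun u => (C / u) ^ (1 / τ)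

theorem measurable_paretoQuantile (τ C : ℝ) : Measurable fun u : ℝ => (C / u) ^ (1 / τ) := by
  fun_prop

instance isProbabilityMeasure_paretoLaw (τ C : ℝ) : IsProbabilityMeasure (paretoLaw τ C) := by
  constructor
  rw [paretoLaw, Measure.map_apply (measurable_paretoQuantile τ C) .univ]
  simp

theorem paretoLaw_Iic_zero {τ C : ℝ} (hC : 0 < C) : paretoLaw τ C (Iic 0) = 0 := by
  rw [paretoLaw, Measure.map_apply (measurable_paretoQuantile τ C) measurableSet_Iic,
    Measure.restrict_apply (measurable_paretoQuantile τ C measurableSet_Iic)]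
  convert measure_empty (μ := (volume : Measure ℝ))
  ext u
  simp only [mem_inter_iff, mem_preimage, mem_Iic, mem_Ioo, mem_empty_iff_false, iff_false]
  rintro ⟨h, hu, -⟩
  exact absurd h (not_le.2 (by positivity))

theorem cdfR_paretoLaw {τ C x : ℝ} (hτ : 0 < τ) (hC : 0 < C) (hx : 0 < x) :
    cdfR (paretoLaw τ C) x = max (1 - C * x ^ (-τ)) 0 := by
  have ht : 0 < C * x ^ (-τ) := by positivity
  rw [cdfR, paretoLaw, Measure.map_apply (measurable_paretoQuantile τ C) measurableSet_Iic,
    Measure.restrict_apply (measurable_paretoQuantile τ C measurableSet_Iic)]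
  have : (fun u : ℝ => (C / u) ^ (1 / τ)) ⁻¹' Iic x ∩ Ioo 0 1 = Ico (C * x ^ (-τ)) 1 := by
    ext u
    simp only [mem_inter_iff, mem_preimage, mem_Iic, mem_Ioo, mem_Ico]
    have key : 0 < u → ((C / u) ^ (1 / τ) ≤ x ↔ C * x ^ (-τ) ≤ u) := fun hu => by
      rw [one_div, Real.rpow_inv_le_iff_of_pos (by positivity) hx.le hτ, Real.rpow_neg hx.le,
        div_le_iff₀ hu, ← div_eq_mul_inv, div_le_iff₀ (by positivity), mul_comm]
    constructor
    · rintro ⟨h, hu, h1⟩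
      exact ⟨(key hu).1 h, h1⟩
    · rintro ⟨h, h1⟩
      exact ⟨(key (ht.trans_le h)).2 h, ht.trans_le h, h1⟩
  rw [this, Real.volume_Ico, ENNReal.toReal_ofReal']

theorem cdfR_mono (μ : Measure ℝ) [IsFiniteMeasure μ] : Monotone (cdfR μ) := fun _ _ h =>
  ENNReal.toReal_mono (measure_ne_top _ _) (measure_mono (Iic_subset_Iic.2 h))

theorem cdfR_nonneg (μ : Measure ℝ) (x : ℝ) : 0 ≤ cdfR μ x := ENNReal.toReal_nonneg

theorem cdfR_le_one (μ : Measure ℝ) [IsProbabilityMeasure μ] (x : ℝ) : cdfR μ x ≤ 1 :=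
  measureReal_le_one

theorem measureReal_Ioc_eq_cdfR_sub (μ : Measure ℝ) [IsFiniteMeasure μ] {a b : ℝ} (h : a ≤ b) :
    μ.real (Ioc a b) = cdfR μ b - cdfR μ a := by
  rw [← Iic_sdiff_Iic, measureReal_sdiff (Iic_subset_Iic.2 h) measurableSet_Iic]
  rfl

theorem pos_of_cdfR_paretoLaw_pos {τ C x : ℝ} (hC : 0 < C)
    (h : 0 < cdfR (paretoLaw τ C) x) : 0 < x := by
  by_contra! hx
  have := cdfR_mono (paretoLaw τ C) hx
  rw [cdfR, cdfR, paretoLaw_Iic_zero hC] at this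
  exact absurd h (not_lt.2 this)

theorem cdfR_paretoLaw_of_pos {τ C x : ℝ} (hτ : 0 < τ) (hC : 0 < C)
    (h : 0 < cdfR (paretoLaw τ C) x) : cdfR (paretoLaw τ C) x = 1 - C * x ^ (-τ) := by
  have hx := pos_of_cdfR_paretoLaw_pos hC h
  rw [cdfR_paretoLaw hτ hC hx] at h ⊢
  exact max_eq_left ((lt_max_iff.1 h).resolve_right (lt_irrefl _)).le

theorem paretoLaw_mem_SOP {τ β C C' : ℝ} (hτ : 0 < τ) (hC : 0 < C) (hC' : 0 < C') :
    paretoLaw τ C ∈ SOP τ β C C' := by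
  refine ⟨inferInstance, measure_mono_null Iio_subset_Iic_self (paretoLaw_Iic_zero hC), ?_⟩
  intro x hx
  have := pos_of_cdfR_paretoLaw_pos hC hx.1
  rw [cdfR_paretoLaw_of_pos hτ hC hx.1, sub_sub_cancel, sub_self, abs_zero]
  positivity

theorem rpow_mul_one_sub_cdfR_sub_le {τ β C C' x : ℝ} {μ : Measure ℝ} (hμ : μ ∈ SOP τ β C C')
    (hx : 0 < x) (hF : 0 < cdfR μ x) :
    |x ^ τ * (1 - cdfR μ x) - C| ≤ C' * x ^ (-(τ * β)) := by
  have := hμ.1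
  have h := mul_le_mul_of_nonneg_left (hμ.2.2 x ⟨hF, cdfR_le_one μ x⟩)
    (Real.rpow_nonneg hx.le τ)
  have h1 : x ^ τ * x ^ (-τ) = 1 := by rw [← Real.rpow_add hx]; simp
  have h2 : x ^ τ * x ^ (-(τ * (β + 1))) = x ^ (-(τ * β)) := by
    rw [← Real.rpow_add hx]; congr 1; ring
  calc |x ^ τ * (1 - cdfR μ x) - C|
      = |x ^ τ * (1 - cdfR μ x - C * x ^ (-τ))| := by
        congr 1; linear_combination C * h1
    _ = x ^ τ * |1 - cdfR μ x - C * x ^ (-τ)| := by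
        rw [abs_mul, abs_of_nonneg (Real.rpow_nonneg hx.le τ)]
    _ ≤ x ^ τ * (C' * x ^ (-(τ * (β + 1)))) := h
    _ = C' * x ^ (-(τ * β)) := by rw [← h2]; ring

theorem tendsto_cdfR_atTop (μ : Measure ℝ) [IsProbabilityMeasure μ] :
    Tendsto (cdfR μ) atTop (nhds 1) := by
  have := (ENNReal.tendsto_toReal ENNReal.one_ne_top).comp
    (measure_univ (μ := μ) ▸ tendsto_measure_Iic_atTop μ)
  rwa [ENNReal.toReal_one] at this

theorem exists_rpow_mul_one_sub_cdfR_le {τ β C C' : ℝ} {μ : Measure ℝ} (hτ : 0 < τ)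
    (hβ : 0 < β) (hC' : 0 < C') (hμ : μ ∈ SOP τ β C C') :
    ∃ M, ∀ x, 0 < x → |x ^ τ * (1 - cdfR μ x)| ≤ M := by
  have := hμ.1
  obtain ⟨x₀, h0, h1⟩ := (((tendsto_cdfR_atTop μ).eventually_const_lt one_pos).and
    (eventually_ge_atTop 1)).exists
  refine ⟨max (C + C') (x₀ ^ τ), fun x hx => ?_⟩
  rw [abs_of_nonneg (mul_nonneg (Real.rpow_nonneg hx.le τ) (sub_nonneg.2 (cdfR_le_one μ x)))]
  rcases le_total x₀ x with h | h
  · refine le_max_of_le_left ?_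
    have h2 := (abs_le.1 (rpow_mul_one_sub_cdfR_sub_le hμ hx (h0.trans_le (cdfR_mono μ h)))).2
    have h3 : x ^ (-(τ * β)) ≤ 1 :=
      Real.rpow_le_one_of_one_le_of_nonpos (h1.trans h) (by nlinarith [mul_pos hτ hβ])
    nlinarith
  · refine le_max_of_le_right ?_
    calc x ^ τ * (1 - cdfR μ x) ≤ x ^ τ * 1 := by
          gcongr; linarith [cdfR_nonneg μ x]
      _ ≤ x₀ ^ τ := by rw [mul_one]; gcongr

theorem pos_of_mem_SOP_of_cdfR_mem_Ioo {τ β C C' x : ℝ} {μ : Measure ℝ} (hτ : 0 < τ)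
    (hβ : 0 < β) (hμ : μ ∈ SOP τ β C C') (hx : cdfR μ x ∈ Ioo (0 : ℝ) 1) : 0 < x := by
  by_contra! h
  rcases h.lt_or_eq with h | rfl
  · refine hx.1.ne' ?_
    rw [cdfR, measure_mono_null (Iic_subset_Iio.2 h) hμ.2.1, ENNReal.toReal_zero]
  · have := hμ.2.2 0 ⟨hx.1, hx.2.le⟩
    rw [Real.zero_rpow (by linarith), Real.zero_rpow (by nlinarith [mul_pos hτ hβ])] at this
    have := (abs_le.1 this).2
    linarith [hx.2]

/-- A lower bound on the distance from the value at a single point. -/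
theorem le_distToSet {τ β₀ β₁ C C' m x : ℝ} {μ : Measure ℝ} (hτ : 0 < τ) (hβ₀ : 0 < β₀)
    (hβ₁ : 0 < β₁) (hC : 0 < C) (hC' : 0 < C') (hμ : μ ∈ SOP τ β₁ C C')
    (hx : cdfR μ x ∈ Ioo (0 : ℝ) 1)
    (h : ∀ ν ∈ SOP τ β₀ C C', m ≤ |x ^ τ * (1 - cdfR μ x) - x ^ τ * (1 - cdfR ν x)|) :
    m ≤ distToSet τ μ (SOP τ β₀ C C') := by
  have : Nonempty (SOP τ β₀ C C') := ⟨_, paretoLaw_mem_SOP hτ hC hC'⟩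
  refine le_ciInf fun ν => ?_
  obtain ⟨M, hM⟩ := exists_rpow_mul_one_sub_cdfR_le hτ hβ₁ hC' hμ
  obtain ⟨N, hN⟩ := exists_rpow_mul_one_sub_cdfR_le hτ hβ₀ hC' ν.2
  refine le_ciSup_of_le ⟨M + N, ?_⟩ (⟨x, hx⟩ : {x : ℝ | cdfR μ x ∈ Ioo (0 : ℝ) 1}) (h ν ν.2)
  rintro _ ⟨y, rfl⟩
  have hy := pos_of_mem_SOP_of_cdfR_mem_Ioo hτ hβ₁ hμ y.2
  exact (abs_sub _ _).trans (add_le_add (hM y hy) (hN y hy))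

/-- A density moving a fraction `ε` of the mass of `Ioc a b` to `Ioc b c`. -/
def shiftDensity (a b c ε x : ℝ) : ℝ :=
  1 + (Ioc b c).indicator (fun _ => ε) x - (Ioc a b).indicator (fun _ => ε) x

theorem shiftDensity_nonneg {a b c ε : ℝ} (h0 : 0 ≤ ε) (h1 : ε ≤ 1) (x : ℝ) :
    0 ≤ shiftDensity a b c ε x := by
  unfold shiftDensity
  have : 0 ≤ (Ioc b c).indicator (fun _ => ε) x := indicator_nonneg (fun _ _ => h0) x
  have : (Ioc a b).indicator (fun _ => ε) x ≤ 1 := indicator_le' (fun _ _ => h1) (by simp) x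
  linarith

theorem shiftDensity_sq (a b c ε x : ℝ) : shiftDensity a b c ε x ^ 2 =
    1 + (Ioc b c).indicator (fun _ => 2 * ε + ε ^ 2) x -
      (Ioc a b).indicator (fun _ => 2 * ε - ε ^ 2) x := by
  unfold shiftDensity
  by_cases hb : x ∈ Ioc b c <;> by_cases ha : x ∈ Ioc a b
  · exact absurd hb.1 (not_lt.2 ha.2)
  all_goals simp only [indicator, ha, hb, if_true, if_false]; ring

theorem integrable_indicator_Ioc (μ : Measure ℝ) [IsFiniteMeasure μ] (a b e : ℝ) :
    Integrable ((Ioc a b).indicator fun _ => e) μ :=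
  (integrable_const e).indicator measurableSet_Ioc

theorem integrable_shiftDensity (μ : Measure ℝ) [IsFiniteMeasure μ] (a b c ε : ℝ) :
    Integrable (shiftDensity a b c ε) μ :=
  ((integrable_const 1).add (integrable_indicator_Ioc μ b c ε)).sub
    (integrable_indicator_Ioc μ a b ε)

theorem integral_one_add_indicator_sub (μ : Measure ℝ) [IsFiniteMeasure μ] (a b c d e : ℝ) :
    ∫ x, (1 + (Ioc b c).indicator (fun _ => d) x - (Ioc a b).indicator (fun _ => e) x) ∂μ =
      μ.real univ + d * μ.real (Ioc b c) - e * μ.real (Ioc a b) := by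
  have h : Integrable (fun x => 1 + (Ioc b c).indicator (fun _ => d) x) μ :=
    (integrable_const 1).add (integrable_indicator_Ioc μ b c d)
  rw [integral_sub h (integrable_indicator_Ioc μ a b e), integral_add (integrable_const 1)
    (integrable_indicator_Ioc μ b c d), integral_indicator measurableSet_Ioc,
    integral_indicator measurableSet_Ioc]
  simp [mul_comm]

theorem integrable_shiftDensity_sq (μ : Measure ℝ) [IsFiniteMeasure μ] (a b c ε : ℝ) :
    Integrable (fun x => shiftDensity a b c ε x ^ 2) μ := by
  simp only [shiftDensity_sq]
  exact ((integrable_const 1).add (integrable_indicator_Ioc μ b c _)).sub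
    (integrable_indicator_Ioc μ a b _)

/-- The law with density `shiftDensity a b c ε` with respect to `μ`. -/
def shiftLaw (μ : Measure ℝ) (a b c ε : ℝ) : Measure ℝ :=
  μ.withDensity fun x => ENNReal.ofReal (shiftDensity a b c ε x)

theorem shiftLaw_real (μ : Measure ℝ) [IsFiniteMeasure μ] {a b c ε : ℝ} (h0 : 0 ≤ ε)
    (h1 : ε ≤ 1) {s : Set ℝ} (hs : MeasurableSet s) :
    (shiftLaw μ a b c ε s).toReal =
      μ.real s + ε * μ.real (Ioc b c ∩ s) - ε * μ.real (Ioc a b ∩ s) := by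
  rw [shiftLaw, withDensity_apply _ hs, ← ofReal_integral_eq_lintegral_ofReal
    (integrable_shiftDensity μ a b c ε).integrableOn (ae_of_all _ (shiftDensity_nonneg h0 h1)),
    ENNReal.toReal_ofReal (integral_nonneg (shiftDensity_nonneg h0 h1))]
  simp only [shiftDensity]
  rw [integral_one_add_indicator_sub]
  simp [measureReal_restrict_apply measurableSet_Ioc]

theorem integral_shiftDensity_of_eq (μ : Measure ℝ) [IsProbabilityMeasure μ] {a b c p ε : ℝ}
    (hab : μ.real (Ioc a b) = p) (hbc : μ.real (Ioc b c) = p) :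
    ∫ x, shiftDensity a b c ε x ∂μ = 1 := by
  simp only [shiftDensity]
  rw [integral_one_add_indicator_sub, hab, hbc, probReal_univ]
  ring

theorem integral_shiftDensity_sq_of_eq (μ : Measure ℝ) [IsProbabilityMeasure μ] {a b c p ε : ℝ}
    (hab : μ.real (Ioc a b) = p) (hbc : μ.real (Ioc b c) = p) :
    ∫ x, shiftDensity a b c ε x ^ 2 ∂μ = 1 + 2 * ε ^ 2 * p := by
  simp only [shiftDensity_sq]
  rw [integral_one_add_indicator_sub, hab, hbc, probReal_univ]
  ring

theorem isProbabilityMeasure_shiftLaw (μ : Measure ℝ) [IsProbabilityMeasure μ] {a b c p ε : ℝ}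
    (h0 : 0 ≤ ε) (h1 : ε ≤ 1) (hab : μ.real (Ioc a b) = p) (hbc : μ.real (Ioc b c) = p) :
    IsProbabilityMeasure (shiftLaw μ a b c ε) := by
  constructor
  rw [shiftLaw, withDensity_apply _ .univ, Measure.restrict_univ,
    ← ofReal_integral_eq_lintegral_ofReal (integrable_shiftDensity μ a b c ε)
    (ae_of_all _ (shiftDensity_nonneg h0 h1)), integral_shiftDensity_of_eq μ hab hbc,
    ENNReal.ofReal_one]

theorem cdfR_pos_of_cdfR_shiftLaw_pos {μ : Measure ℝ} [IsFiniteMeasure μ] {a b c ε x : ℝ}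
    (h : 0 < cdfR (shiftLaw μ a b c ε) x) : 0 < cdfR μ x := by
  by_contra! h'
  have h2 : μ (Iic x) = 0 := by
    have : (μ (Iic x)).toReal = 0 := le_antisymm h' (cdfR_nonneg μ x)
    simpa [ENNReal.toReal_eq_zero_iff] using this
  have h3 : shiftLaw μ a b c ε (Iic x) = 0 := withDensity_absolutelyContinuous _ _ h2
  rw [cdfR, h3] at h
  exact lt_irrefl _ h

/-- The cdf moves by at most `ε * p`. -/
theorem abs_cdfR_shiftLaw_sub_le (μ : Measure ℝ) [IsProbabilityMeasure μ] {a b c p ε : ℝ}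
    (h0 : 0 ≤ ε) (h1 : ε ≤ 1) (hab : μ.real (Ioc a b) = p) (hbc : μ.real (Ioc b c) = p) (x : ℝ) :
    |cdfR (shiftLaw μ a b c ε) x - cdfR μ x| ≤ ε * p := by
  rw [cdfR, shiftLaw_real μ h0 h1 measurableSet_Iic, cdfR, ← measureReal_def]
  have h2 : μ.real (Ioc b c ∩ Iic x) ≤ p := hbc ▸ measureReal_mono inter_subset_left
  have h3 : μ.real (Ioc a b ∩ Iic x) ≤ p := hab ▸ measureReal_mono inter_subset_left
  have h4 : 0 ≤ μ.real (Ioc b c ∩ Iic x) := measureReal_nonneg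
  have h5 : 0 ≤ μ.real (Ioc a b ∩ Iic x) := measureReal_nonneg
  rw [abs_le]
  constructor <;> nlinarith

theorem cdfR_shiftLaw_of_ge (μ : Measure ℝ) [IsProbabilityMeasure μ] {a b c p ε x : ℝ}
    (h0 : 0 ≤ ε) (h1 : ε ≤ 1) (hab : μ.real (Ioc a b) = p) (hbc : μ.real (Ioc b c) = p)
    (hx : c ≤ x) (hbx : b ≤ x) : cdfR (shiftLaw μ a b c ε) x = cdfR μ x := by
  rw [cdfR, shiftLaw_real μ h0 h1 measurableSet_Iic,
    inter_eq_left.2 fun y hy => hy.2.trans hx, inter_eq_left.2 fun y hy => hy.2.trans hbx,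
    hab, hbc, add_sub_cancel_right]
  rfl

theorem cdfR_shiftLaw_mid (μ : Measure ℝ) [IsProbabilityMeasure μ] {a b c p ε : ℝ}
    (h0 : 0 ≤ ε) (h1 : ε ≤ 1) (hab : μ.real (Ioc a b) = p) :
    cdfR (shiftLaw μ a b c ε) b = cdfR μ b - ε * p := by
  have : Ioc b c ∩ Iic b = ∅ := by
    ext y; simp only [mem_inter_iff, mem_Ioc, mem_Iic, mem_empty_iff_false, iff_false]
    rintro ⟨⟨h, -⟩, h'⟩; exact absurd h (not_lt.2 h')
  rw [cdfR, shiftLaw_real μ h0 h1 measurableSet_Iic, this,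
    inter_eq_left.2 fun y hy => hy.2, hab, measureReal_empty, mul_zero, add_zero]
  rfl

/-- The `(1 - t)`-quantile of the Pareto law. -/
def paretoPoint (τ C t : ℝ) : ℝ := (C / t) ^ (1 / τ)

theorem paretoPoint_pos {τ C t : ℝ} (hC : 0 < C) (ht : 0 < t) : 0 < paretoPoint τ C t := by
  unfold paretoPoint; positivity

theorem paretoPoint_anti {τ C s t : ℝ} (hτ : 0 < τ) (hC : 0 < C) (hs : 0 < s) (hst : s ≤ t) :
    paretoPoint τ C t ≤ paretoPoint τ C s := by
  unfold paretoPoint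
  have := hs.trans_le hst
  gcongr

theorem paretoPoint_rpow {τ C t : ℝ} (hτ : 0 < τ) (hC : 0 < C) (ht : 0 < t) (r : ℝ) :
    paretoPoint τ C t ^ (τ * r) = (C / t) ^ r := by
  rw [paretoPoint, ← Real.rpow_mul (by positivity), one_div, inv_mul_cancel_left₀ hτ.ne']

theorem paretoPoint_rpow_neg {τ C t : ℝ} (hτ : 0 < τ) (hC : 0 < C) (ht : 0 < t) (r : ℝ) :
    paretoPoint τ C t ^ (-(τ * r)) = (t / C) ^ r := by
  rw [Real.rpow_neg (paretoPoint_pos hC ht).le, paretoPoint_rpow hτ hC ht,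
    ← Real.inv_rpow (by positivity), inv_div]

theorem cdfR_paretoLaw_paretoPoint {τ C t : ℝ} (hτ : 0 < τ) (hC : 0 < C) (ht : 0 < t)
    (ht1 : t ≤ 1) : cdfR (paretoLaw τ C) (paretoPoint τ C t) = 1 - t := by
  have := paretoPoint_rpow_neg hτ hC ht 1
  rw [mul_one, Real.rpow_one] at this
  rw [cdfR_paretoLaw hτ hC (paretoPoint_pos hC ht), this, mul_div_cancel₀ _ hC.ne']
  exact max_eq_left (by linarith)

/-- The alternative: the Pareto law with a fraction `ε` of the mass between the tail levels
`3 * p` and `2 * p` moved between the levels `2 * p` and `p`. -/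
def shiftedPareto (τ C p ε : ℝ) : Measure ℝ :=
  shiftLaw (paretoLaw τ C) (paretoPoint τ C (3 * p)) (paretoPoint τ C (2 * p))
    (paretoPoint τ C p) ε

theorem paretoLaw_real_Ioc {τ C s t : ℝ} (hτ : 0 < τ) (hC : 0 < C) (hs : 0 < s) (hst : s ≤ t)
    (ht : t ≤ 1) :
    (paretoLaw τ C).real (Ioc (paretoPoint τ C t) (paretoPoint τ C s)) = t - s := by
  rw [measureReal_Ioc_eq_cdfR_sub _ (paretoPoint_anti hτ hC hs hst),
    cdfR_paretoLaw_paretoPoint hτ hC hs (hst.trans ht),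
    cdfR_paretoLaw_paretoPoint hτ hC (hs.trans_le hst) ht]
  ring

theorem paretoLaw_real_Ioc_left {τ C p : ℝ} (hτ : 0 < τ) (hC : 0 < C) (hp : 0 < p)
    (hp1 : 4 * p ≤ 1) :
    (paretoLaw τ C).real (Ioc (paretoPoint τ C (3 * p)) (paretoPoint τ C (2 * p))) = p := by
  rw [paretoLaw_real_Ioc hτ hC (by positivity) (by linarith) (by linarith)]
  ring

theorem paretoLaw_real_Ioc_right {τ C p : ℝ} (hτ : 0 < τ) (hC : 0 < C) (hp : 0 < p)
    (hp1 : 4 * p ≤ 1) :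
    (paretoLaw τ C).real (Ioc (paretoPoint τ C (2 * p)) (paretoPoint τ C p)) = p := by
  rw [paretoLaw_real_Ioc hτ hC (by positivity) (by linarith) (by linarith)]
  ring

theorem shiftedPareto_mem_SOP {τ β C C' p ε : ℝ} (hτ : 0 < τ) (hβ : 0 < β) (hC : 0 < C)
    (hC' : 0 < C') (hp : 0 < p) (hp1 : 4 * p ≤ 1) (h0 : 0 ≤ ε) (h1 : ε ≤ 1)
    (hε : ε * p ≤ C' * (p / C) ^ (β + 1)) : shiftedPareto τ C p ε ∈ SOP τ β C C' := by
  have hl := paretoLaw_real_Ioc_left hτ hC hp hp1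
  have hr := paretoLaw_real_Ioc_right hτ hC hp hp1
  refine ⟨isProbabilityMeasure_shiftLaw _ h0 h1 hl hr, withDensity_absolutelyContinuous _ _
    (measure_mono_null Iio_subset_Iic_self (paretoLaw_Iic_zero hC)), fun x hx => ?_⟩
  have hpos := cdfR_pos_of_cdfR_shiftLaw_pos hx.1
  have hx0 := pos_of_cdfR_paretoLaw_pos hC hpos
  have hF := cdfR_paretoLaw_of_pos hτ hC hpos
  have e : 1 - cdfR (shiftedPareto τ C p ε) x - C * x ^ (-τ) =
      -(cdfR (shiftedPareto τ C p ε) x - cdfR (paretoLaw τ C) x) := by rw [hF]; ring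
  rw [e, abs_neg]
  rcases le_total (paretoPoint τ C p) x with h | h
  · rw [shiftedPareto, cdfR_shiftLaw_of_ge _ h0 h1 hl hr h
      ((paretoPoint_anti hτ hC hp (by linarith)).trans h), sub_self, abs_zero]
    positivity
  · refine (abs_cdfR_shiftLaw_sub_le _ h0 h1 hl hr x).trans (hε.trans ?_)
    rw [← paretoPoint_rpow_neg hτ hC hp]
    have := Real.rpow_le_rpow_of_nonpos hx0 h
      (show -(τ * (β + 1)) ≤ 0 by nlinarith [mul_pos hτ hβ])
    gcongr

theorem le_distToSet_shiftedPareto {τ β₀ β₁ C C' p ε : ℝ} (hτ : 0 < τ) (hβ₀ : 0 < β₀)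
    (hβ₁ : 0 < β₁) (hC : 0 < C) (hC' : 0 < C') (hp : 0 < p) (hp1 : 4 * p ≤ 1) (h0 : 0 ≤ ε)
    (h1 : ε ≤ 1) (hε : ε * p ≤ C' * (p / C) ^ (β₁ + 1))
    (hε₀ : C' * (2 * p / C) ^ β₀ ≤ C * ε / 4) :
    C * ε / 4 ≤ distToSet τ (shiftedPareto τ C p ε) (SOP τ β₀ C C') := by
  have h2p : 0 < 2 * p := by positivity
  have hF : cdfR (shiftedPareto τ C p ε) (paretoPoint τ C (2 * p)) = 1 - 2 * p - ε * p := by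
    rw [shiftedPareto, cdfR_shiftLaw_mid _ h0 h1 (paretoLaw_real_Ioc_left hτ hC hp hp1),
      cdfR_paretoLaw_paretoPoint hτ hC h2p (by linarith)]
  refine le_distToSet (x := paretoPoint τ C (2 * p)) hτ hβ₀ hβ₁ hC hC'
    (shiftedPareto_mem_SOP hτ hβ₁ hC hC' hp hp1 h0 h1 hε) ?_ fun ν hν => ?_
  · rw [hF]; constructor <;> nlinarith
  have hpow := paretoPoint_rpow hτ hC h2p 1
  rw [mul_one, Real.rpow_one] at hpow
  have hμ : C / (2 * p) * (1 - (1 - 2 * p - ε * p)) = C + C * ε / 2 := by field_simp; ring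
  rw [hF, hpow, hμ]
  rcases (cdfR_nonneg ν (paretoPoint τ C (2 * p))).eq_or_lt with h | h
  · have : 2 * C ≤ C / (2 * p) := by rw [le_div_iff₀ h2p]; nlinarith
    rw [← h, sub_zero, mul_one, abs_sub_comm]
    refine le_trans ?_ (le_abs_self _)
    nlinarith
  · have := rpow_mul_one_sub_cdfR_sub_le hν (paretoPoint_pos hC h2p) h
    rw [hpow, paretoPoint_rpow_neg hτ hC h2p] at this
    refine le_trans ?_ (le_abs_self _)
    linarith [(abs_le.1 this).2]

/-- Indistinguishability of the Pareto law and its perturbation from `n` observations. -/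
theorem iidP_shiftedPareto_sub_lt {τ C p ε δ : ℝ} {n : ℕ} (hτ : 0 < τ) (hC : 0 < C) (hp : 0 < p)
    (hp1 : 4 * p ≤ 1) (h0 : 0 ≤ ε) (h1 : ε ≤ 1) (hδ : 0 < δ)
    (hn : Real.exp (n * (2 * ε ^ 2 * p)) - 1 < δ ^ 2) {R : Set (Fin n → ℝ)}
    (hR : MeasurableSet R) :
    (iidP (shiftedPareto τ C p ε) n R).toReal - (iidP (paretoLaw τ C) n R).toReal < δ := by
  have hl := paretoLaw_real_Ioc_left hτ hC hp hp1
  have hr := paretoLaw_real_Ioc_right hτ hC hp hp1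
  refine pi_withDensity_sub_pi_lt _ (shiftDensity_nonneg h0 h1) (integrable_shiftDensity _ _ _ _ _)
    (integrable_shiftDensity_sq _ _ _ _ _) (integral_shiftDensity_of_eq _ hl hr) hδ ?_ hR
  rw [integral_shiftDensity_sq_of_eq _ hl hr, Fintype.card_fin]
  refine lt_of_le_of_lt (sub_le_sub_right ?_ 1) hn
  rw [Real.exp_nat_mul]
  gcongr
  linarith [Real.add_one_le_exp (2 * ε ^ 2 * p)]

theorem one_sub_le_sub_of_unifConsistent {α : ℝ} {H₀ H₁ : Set (Measure ℝ)} {n : ℕ}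
    {R : Set (Fin n → ℝ)} (h₀ : ∀ μ ∈ H₀, IsProbabilityMeasure μ)
    (h : (⨆ μ : H₀, (iidP (μ : Measure ℝ) n R).toReal) +
      (⨆ μ : H₁, (1 - (iidP (μ : Measure ℝ) n R).toReal)) ≤ α)
    {μ₀ μ₁ : Measure ℝ} (hμ₀ : μ₀ ∈ H₀) (hμ₁ : μ₁ ∈ H₁) :
    1 - α ≤ (iidP μ₁ n R).toReal - (iidP μ₀ n R).toReal := by
  have b₀ : BddAbove (range fun μ : H₀ => (iidP (μ : Measure ℝ) n R).toReal) := by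
    refine ⟨1, ?_⟩
    rintro _ ⟨μ, rfl⟩
    have := h₀ μ μ.2
    exact measureReal_le_one (μ := Measure.pi fun _ => (μ : Measure ℝ))
  have b₁ : BddAbove (range fun μ : H₁ => 1 - (iidP (μ : Measure ℝ) n R).toReal) := by
    refine ⟨1, ?_⟩
    rintro _ ⟨μ, rfl⟩
    exact sub_le_self _ ENNReal.toReal_nonneg
  have := le_ciSup b₀ ⟨μ₀, hμ₀⟩
  have := le_ciSup b₁ ⟨μ₁, hμ₁⟩
  dsimp only at *
  linarith

theorem tendsto_const_mul_rpow_nhdsGT_zero (k : ℝ) {r : ℝ} (hr : 0 < r) :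
    Tendsto (fun p : ℝ => k * p ^ r) (nhdsWithin 0 (Ioi 0)) (nhds 0) := by
  have h : ContinuousAt (fun p : ℝ => k * p ^ r) 0 :=
    continuousAt_const.mul (Real.continuousAt_rpow_const 0 r (Or.inr hr.le))
  have := h.tendsto
  rw [Real.zero_rpow hr.ne', mul_zero] at this
  exact this.mono_left nhdsWithin_le_nhds

/-- For small `p` and `ε = κ * p ^ β₁`, the perturbation of the Pareto law is admissible and its
distance to the null hypothesis is of order `ε`. -/
theorem eventually_small_perturbation {C C' β₀ β₁ κ : ℝ} (hC : 0 < C) (hβ₁ : 0 < β₁)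
    (hβ : β₁ < β₀) (hκ : 0 < κ) :
    ∀ᶠ p : ℝ in nhdsWithin 0 (Ioi 0), 0 < p ∧ 4 * p ≤ 1 ∧ κ * p ^ β₁ ≤ 1 ∧
      C' * (2 * p / C) ^ β₀ ≤ C * (κ * p ^ β₁) / 4 := by
  have h1 := (tendsto_const_mul_rpow_nhdsGT_zero 4 one_pos).eventually_le_const one_pos
  have h2 := (tendsto_const_mul_rpow_nhdsGT_zero κ hβ₁).eventually_le_const one_pos
  have h3 := (tendsto_const_mul_rpow_nhdsGT_zero (C' * (2 / C) ^ β₀)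
    (sub_pos.2 hβ)).eventually_le_const (show 0 < C * κ / 4 by positivity)
  filter_upwards [self_mem_nhdsWithin, h1, h2, h3] with p hp h1 h2 h3
  have hp : 0 < p := hp
  rw [Real.rpow_one] at h1
  refine ⟨hp, h1, h2, ?_⟩
  have e : (2 * p / C) ^ β₀ = (2 / C) ^ β₀ * (p ^ (β₀ - β₁) * p ^ β₁) := by
    rw [← Real.rpow_add hp, sub_add_cancel, ← Real.mul_rpow (by positivity) hp.le]
    congr 1; ring
  rw [e]
  have := mul_le_mul_of_nonneg_right h3 (Real.rpow_nonneg hp.le β₁)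
  linarith

theorem exists_exp_rpow_sub_one_lt (k : ℝ) {r δ : ℝ} (hr : 0 < r) (hδ : 0 < δ) :
    ∃ a > 0, Real.exp (k * a ^ r) - 1 < δ := by
  have h := (Real.continuous_exp.tendsto 0).comp (tendsto_const_mul_rpow_nhdsGT_zero k hr)
  rw [Real.exp_zero] at h
  obtain ⟨a, h1, h2⟩ := ((h.eventually_lt_const (show (1 : ℝ) < 1 + δ by linarith)).and
    self_mem_nhdsWithin).exists
  exact ⟨a, h2, sub_left_lt_of_lt_add h1⟩

/-- Theorem 1.B: if an `α`-uniformly consistent test of `H₀ : F ∈ S(τ,β₀,C,C')` vs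
`H₁ : F ∈ S̃(τ,β₁,β₀,C,C',ρ_n)` exists, then `liminf ρ_n·n^{β₁/(2β₁+1)} > 0`. -/
theorem two_point_test_lower_bound
    (α τ C C' β₀ β₁ : ℝ) (hα : α ∈ Ioo (0 : ℝ) 1) (hτ : 0 < τ) (hC : 0 < C)
    (hC' : 0 < C') (hβ₁ : 0 < β₁) (hβ : β₁ < β₀)
    (ρ : ℕ → ℝ) (hρ : ∀ n, 0 ≤ ρ n)
    (htest : ∃ R : (n : ℕ) → Set (Fin n → ℝ),
      UnifConsistent α (fun _ => SOP τ β₀ C C')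
        (fun n => SOPsep τ β₁ β₀ C C' (ρ n)) R) :
    ∃ c > (0 : ℝ), ∀ᶠ n : ℕ in atTop, c ≤ ρ n * (n : ℝ) ^ (β₁ / (2 * β₁ + 1)) := by
  obtain ⟨R, hR, hev⟩ := htest
  have hr : 0 < 2 * β₁ + 1 := by positivity
  set κ := C' / C ^ (β₁ + 1)
  have hκ : 0 < κ := by positivity
  have hδ : 0 < 1 - α := sub_pos.2 hα.2
  obtain ⟨a, ha, hexp⟩ := exists_exp_rpow_sub_one_lt (2 * κ ^ 2) hr (pow_pos hδ 2)
  have htend : Tendsto (fun n : ℕ => a * (n : ℝ) ^ (-(1 / (2 * β₁ + 1)))) atTop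
      (nhdsWithin 0 (Ioi 0)) := by
    refine tendsto_nhdsWithin_iff.2 ⟨?_, ?_⟩
    · simpa using ((tendsto_rpow_neg_atTop (show 0 < 1 / (2 * β₁ + 1) by positivity)).comp
        tendsto_natCast_atTop_atTop).const_mul a
    · filter_upwards [eventually_gt_atTop 0] with n hn
      have : (0 : ℝ) < n := Nat.cast_pos.2 hn
      exact mem_Ioi.2 (by positivity)
  refine ⟨C * κ * a ^ β₁ / 4, by positivity, ?_⟩
  filter_upwards [hev, htend.eventually (eventually_small_perturbation (C' := C') hC hβ₁ hβ hκ),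
    eventually_gt_atTop 0] with n hn hp hn0
  have hn0 : (0 : ℝ) < n := Nat.cast_pos.2 hn0
  set p := a * (n : ℝ) ^ (-(1 / (2 * β₁ + 1))) with hpdef
  obtain ⟨hp0, hp1, hε1, hε₀⟩ := hp
  have hε0 : 0 ≤ κ * p ^ β₁ := by positivity
  have hpow (r : ℝ) : p ^ r = a ^ r * (n : ℝ) ^ (-(r / (2 * β₁ + 1))) := by
    rw [hpdef, Real.mul_rpow ha.le (by positivity), ← Real.rpow_mul hn0.le]
    congr 2; ring
  have hε : κ * p ^ β₁ * p ≤ C' * (p / C) ^ (β₁ + 1) := by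
    rw [Real.div_rpow hp0.le hC.le, Real.rpow_add_one hp0.ne']
    exact le_of_eq (by simp only [κ]; ring)
  by_contra! hlt
  have hρn : ρ n ≤ C * (κ * p ^ β₁) / 4 := by
    have h := mul_le_mul_of_nonneg_right hlt.le
      (Real.rpow_nonneg hn0.le (-(β₁ / (2 * β₁ + 1))))
    rw [mul_assoc, ← Real.rpow_add hn0, add_neg_cancel, Real.rpow_zero, mul_one] at h
    rw [hpow]
    linarith
  have hmem : shiftedPareto τ C p (κ * p ^ β₁) ∈ SOPsep τ β₁ β₀ C C' (ρ n) :=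
    ⟨shiftedPareto_mem_SOP hτ hβ₁ hC hC' hp0 hp1 hε0 hε1 hε, hρn.trans
      (le_distToSet_shiftedPareto hτ (hβ₁.trans hβ) hβ₁ hC hC' hp0 hp1 hε0 hε1 hε hε₀)⟩
  have hle := one_sub_le_sub_of_unifConsistent (fun μ hμ => hμ.1) hn
    (paretoLaw_mem_SOP hτ hC hC') hmem
  refine absurd hle (not_le.2 (iidP_shiftedPareto_sub_lt hτ hC hp0 hp1 hε0 hε1 hδ ?_ (hR n)))
  have e : (n : ℝ) * (2 * (κ * p ^ β₁) ^ 2 * p) = 2 * κ ^ 2 * a ^ (2 * β₁ + 1) := by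
    have h1 : (p ^ β₁) ^ 2 * p = p ^ (2 * β₁ + 1) := by
      rw [Real.rpow_add_one hp0.ne', mul_comm 2 β₁, Real.rpow_mul hp0.le, Real.rpow_two]
    have h2 : (n : ℝ) * (n : ℝ) ^ (-((2 * β₁ + 1) / (2 * β₁ + 1))) = 1 := by
      rw [div_self hr.ne', Real.rpow_neg_one, mul_inv_cancel₀ hn0.ne']
    have h3 := h1.trans (hpow _)
    linear_combination 2 * κ ^ 2 * n * h3 + 2 * κ ^ 2 * a ^ (2 * β₁ + 1) * h2
  rwa [e]

end
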